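/- For every natural number n and every integer j with j ≡ 0, 3, or 4 (mod 5), the number p_j(5n+1) of partitions of 5n+1 with BG-rank j is divisible by 5. -/

import Mathlib

/-- A partition, represented as a weakly decreasing list of positive integers. -/
def IsPartition (l : List ℕ) : Prop :=
  l.Pairwise (· ≥ ·) ∧ ∀ x ∈ l, 0 < x

/-- The BG-rank of a partition `λ₁ ≥ λ₂ ≥ …`:  `Σᵢ (−1)^(i+1) (λᵢ mod 2)`
(with 1-based indexing, i.e. the first part contributes with sign `+1`). -/
def bgRank (l : List ℕ) : ℤ :=
  ∑ i ∈ Finset.range l.length, (-1 : ℤ) ^ i * ((l.getD i 0 : ℤ) % 2)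

/-- `p n`, the number of partitions of `n`. -/
noncomputable def partitionCount (n : ℕ) : ℕ :=
  Nat.card {l : List ℕ // IsPartition l ∧ l.sum = n}

/-- `p_j(n)`, the number of partitions of `n` with BG-rank `j`. -/
noncomputable def pj (j : ℤ) (n : ℕ) : ℕ :=
  Nat.card {l : List ℕ // IsPartition l ∧ l.sum = n ∧ bgRank l = j}

/-- `pp n`, the number of ordered pairs of partitions of total size `n`. -/
noncomputable def pp (n : ℕ) : ℕ :=
  ∑ k ∈ Finset.range (n + 1), partitionCount k * partitionCount (n - k)


section jac
variable {A : Type*} [CommRing A]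

def qP (x : A) (m : ℕ) : A := ∏ i ∈ Finset.range m, (1 - x ^ (i + 1))

lemma qP_succ (x : A) (m : ℕ) : qP x (m+1) = qP x m * (1 - x ^ (m+1)) := by
  simp [qP, Finset.prod_range_succ]

def iq (u : ℕ → A) (m : ℤ) : A := if m < 0 then 0 else u m.toNat

def tri (k : ℤ) : ℕ := (k * (k - 1) / 2).toNat

lemma two_mul_tri (k : ℤ) : 2 * (tri k : ℤ) = k * (k - 1) := by
  have h : Even (k * (k - 1)) := by
    have := Int.even_mul_succ_self (k-1)
    rw [mul_comm]; simpa using this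
  obtain ⟨c, hc⟩ := h
  have h0 : 0 ≤ k * (k - 1) := by
    rcases le_or_gt k 0 with h | h <;> nlinarith
  have : k * (k-1) / 2 = c := by omega
  simp only [tri, this]
  omega

lemma tri_sub (k : ℤ) : (tri (k - 1) : ℤ) = tri k - (k - 1) := by
  have h1 := two_mul_tri k
  have h2 := two_mul_tri (k - 1)
  linarith

lemma tri_add (k : ℤ) : (tri (k + 1) : ℤ) = tri k + k := by
  have h1 := two_mul_tri k
  have h2 := two_mul_tri (k + 1)
  linarith

lemma iq_step (x : A) (u : ℕ → A) (hu : ∀ m, u m * qP x m = 1) (m : ℤ) :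
    iq u m = (1 - x ^ (m+1).toNat) * iq u (m+1) := by
  unfold iq
  by_cases h : m < 0
  · have : (m+1).toNat = 0 := by omega
    simp [h, this]
  · have h1 : ¬ (m + 1 < 0) := by omega
    have h2 : (m+1).toNat = m.toNat + 1 := by omega
    simp only [h, h1, if_false, h2]
    have e1 := hu m.toNat
    have e2 := hu (m.toNat+1)
    rw [qP_succ] at e2
    linear_combination (-u m.toNat) * e2 + (u (m.toNat+1) * (1 - x ^ (m.toNat+1))) * e1

def sg (k : ℤ) : ℤ := if k % 2 = 0 then 1 else -1
lemma sg_sub (k : ℤ) : sg (k-1) = - sg k := by unfold sg; split_ifs <;> omega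
lemma sg_add (k : ℤ) : sg (k+1) = - sg k := by unfold sg; split_ifs <;> omega

def an (x : A) (u : ℕ → A) (n : ℕ) (k : ℤ) : A :=
  (sg k : A) * x ^ tri k * iq u (n + k) * iq u (n + 1 - k) * qP x (2*n+1)

lemma an_zero (x : A) (u : ℕ → A) (n : ℕ) (k : ℤ) (hk : k < -n ∨ n + 1 < k) : an x u n k = 0 := by
  unfold an iq
  rcases hk with h | h
  · rw [if_pos (by omega)]; simp
  · rw [if_pos (c := (n + 1 - k : ℤ) < 0) (by omega)]; simp

lemma an_rec (x : A) (u : ℕ → A) (hu : ∀ m, u m * qP x m = 1) (n : ℕ) (k : ℤ) :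
    an x u (n+1) k = (1 + x^(2*n+2)) * an x u n k
      - x^(n+1) * (an x u n (k-1) + an x u n (k+1)) := by
  by_cases hk : k < -n-1 ∨ n + 2 < k
  · rw [an_zero _ _ _ _ (by omega), an_zero _ _ _ _ (by omega), an_zero _ _ _ _ (by omega),
      an_zero _ _ _ _ (by omega)]
    simp
  have hq : qP x (2*(n+1)+1) = qP x (2*n+1) * (1 - x^(2*n+2)) * (1 - x^(2*n+3)) := by
    rw [show 2*(n+1)+1 = 2*n+1+1+1 by ring, qP_succ, qP_succ]
  obtain ⟨p, hp⟩ : ∃ p : ℕ, (p : ℤ) = n + 1 + k := ⟨(n+1+k).toNat, by omega⟩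
  obtain ⟨r, hr⟩ : ∃ r : ℕ, (r : ℤ) = n + 2 - k := ⟨(n+2-k).toNat, by omega⟩
  have i1 := iq_step x u hu (n + k)
  have i2 := iq_step x u hu (n + k - 1)
  have i3 := iq_step x u hu (n + 1 - k)
  have i4 := iq_step x u hu (n - k)
  rw [show (n + k - 1 + 1 : ℤ) = n + k by ring, i1] at i2
  rw [show (n - k + 1 : ℤ) = n + 1 - k by ring, i3] at i4
  rw [show (n + k + 1 : ℤ) = p by omega, Int.toNat_natCast] at i1 i2
  rw [show (n + 1 - k + 1 : ℤ) = r by omega, Int.toNat_natCast] at i3 i4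
  have hpr : x^p * x^r = x^(2*n+3) := by rw [← pow_add]; congr 1; omega
  have ht1 : x^(n+1) * x^(tri (k-1)) = x^(tri k) * x^r := by
    rw [← pow_add, ← pow_add]; congr 1; have := tri_sub k; omega
  have ht2 : x^(n+1) * x^(tri (k+1)) = x^(tri k) * x^p := by
    rw [← pow_add, ← pow_add]; congr 1; have := tri_add k; omega
  have hy : x^r * ((1 - x^(n+k).toNat) * (1 - x^p)) = (x^r - x^(2*n+2)) * (1 - x^p) := by
    by_cases h0 : p = 0
    · simp [h0]
    · have : x^r * x^(n+k).toNat = x^(2*n+2) := by rw [← pow_add]; congr 1; omega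
      rw [← this]; ring
  have hw : x^p * ((1 - x^(n+1-k).toNat) * (1 - x^r)) = (x^p - x^(2*n+2)) * (1 - x^r) := by
    by_cases h0 : r = 0
    · simp [h0]
    · have : x^p * x^(n+1-k).toNat = x^(2*n+2) := by rw [← pow_add]; congr 1; omega
      rw [← this]; ring
  unfold an
  rw [sg_sub, sg_add, hq]
  rw [show ((n+1:ℕ) + k : ℤ) = p by push_cast; omega,
    show ((n+1:ℕ) + 1 - k : ℤ) = r by push_cast; omega,
    show (n + (k - 1) : ℤ) = n + k - 1 by ring, show (n + 1 - (k-1) : ℤ) = r by omega,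
    show (n + (k + 1) : ℤ) = p by omega, show (n + 1 - (k+1) : ℤ) = n - k by omega, i2, i4, i1, i3]
  push_cast
  rw [← hpr]
  generalize iq u p = α at *
  generalize iq u r = β at *
  generalize qP x (2*n+1) = Z at *
  generalize (sg k : A) = s at *
  generalize x^tri k = t at *
  generalize x^(tri (k-1)) = t1 at *
  generalize x^(tri (k+1)) = t2 at *
  generalize x^(n+1) = X1 at *
  generalize x^(n+k).toNat = Y at *
  generalize x^(n+1-k).toNat = W at *
  generalize x^p = y at *
  generalize x^r = w at *
  generalize x^(2*n+2) = X2 at *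
  linear_combination (-s * Z * α * β * (1 - Y) * (1-y)) * ht1 + (-s * Z * α * β * (1-W)*(1-w)) * ht2
    + (-s*t*Z*α*β) * hy + (-s*t*Z*α*β) * hw

lemma sum_shift (f : ℤ → A) (n : ℕ) (c : ℤ) (hc : |c| ≤ 1) (hf : ∀ k : ℤ, k < -n ∨ n + 1 < k → f k = 0) :
    ∑ k ∈ Finset.Icc (-(n+1:ℕ):ℤ) ((n+1:ℕ)+1), f (k + c) = ∑ k ∈ Finset.Icc (-n:ℤ) (n+1), f k := by
  rw [abs_le] at hc
  rw [← Finset.sum_image (f := f) (g := fun k => k + c) (by intro a _ b _ h; simpa using h)]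
  symm
  apply Finset.sum_subset
  · intro k hk
    simp only [Finset.mem_image, Finset.mem_Icc] at *
    exact ⟨k - c, by push_cast; omega, by ring⟩
  · intro k _ hk
    simp only [Finset.mem_Icc] at hk
    exact hf k (by omega)

lemma jac_fin (x : A) (u : ℕ → A) (hu : ∀ m, u m * qP x m = 1) (n : ℕ) :
    ∑ k ∈ Finset.Icc (-n:ℤ) (n+1), (k : A) * an x u n k = - (qP x n)^2 := by
  induction n with
  | zero =>
    have : Finset.Icc (-(0:ℕ):ℤ) ((0:ℕ)+1) = {0, 1} := by decide
    rw [this]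
    have h0 := hu 0
    have h1 := hu 1
    simp [qP] at h0 h1
    simp [an, iq, sg, tri, qP, h0, h1]
  | succ n ih =>
    have h0 := sum_shift (fun k => (k : A) * an x u n k) n 0 (by simp)
      (fun k hk => by simp [an_zero x u n k hk])
    have h1 := sum_shift (fun k => ((k+1:ℤ) : A) * an x u n k) n (-1) (by simp)
      (fun k hk => by simp [an_zero x u n k hk])
    have h2 := sum_shift (fun k => ((k-1:ℤ) : A) * an x u n k) n 1 (by simp)
      (fun k hk => by simp [an_zero x u n k hk])
    have e : ∀ k : ℤ, (k : A) * an x u (n+1) k = (1 + x^(2*n+2)) * ((k+0:ℤ) * an x u n (k+0))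
      - x^(n+1) * (((k+ -1+1:ℤ) : A) * an x u n (k+ -1) + ((k+1-1:ℤ):A) * an x u n (k+1)) := by
      intro k
      rw [an_rec x u hu]
      simp [← sub_eq_add_neg]
      ring
    simp only [e, Finset.sum_sub_distrib, ← Finset.mul_sum, Finset.sum_add_distrib]
    rw [h0, h1, h2, qP_succ]
    rw [← Finset.sum_add_distrib]
    have e2 : ∑ k ∈ Finset.Icc (-n:ℤ) (n+1), (((k+1:ℤ):A) * an x u n k + ((k-1:ℤ):A) * an x u n k)
      = 2 * ∑ k ∈ Finset.Icc (-n:ℤ) (n+1), (k:A) * an x u n k := by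
      rw [Finset.mul_sum]; apply Finset.sum_congr rfl; intro k _; push_cast; ring
    rw [e2, ih]
    ring

lemma qP_stab (x : A) (M : ℕ) (hx : x^(M+1) = 0) (n : ℕ) (h : M ≤ n) : qP x n = qP x M := by
  induction n, h using Nat.le_induction with
  | base => rfl
  | succ n hn ih => 
    rw [qP_succ, ih, show n+1 = M+1+(n-M) by omega, pow_add, hx]; simp

lemma u_stab (x : A) (u : ℕ → A) (hu : ∀ m, u m * qP x m = 1) (M : ℕ) (hx : x^(M+1) = 0) (n : ℕ) (h : M ≤ n) :
    u n = u M := by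
  have h1 := hu n
  rw [qP_stab x M hx n h] at h1
  have h2 := hu M
  linear_combination (u M) * h1 - u n * h2

lemma jac_nil (x : A) (u : ℕ → A) (hu : ∀ m, u m * qP x m = 1) (M : ℕ) (hx : x^(M+1) = 0) :
    2 * (qP x M)^3 = - ∑ k ∈ Finset.Icc (-(2*M+1:ℕ):ℤ) ((2*M+1:ℕ)+1),
      ((sg k * (2*k-1) : ℤ) : A) * x ^ tri k := by
  have h := jac_fin x u hu (2*M+1)
  rw [qP_stab x M hx (2*M+1) (by omega)] at h
  have e : ∀ k ∈ Finset.Icc (-(2*M+1:ℕ):ℤ) ((2*M+1:ℕ)+1), (k:A) * an x u (2*M+1) k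
    = (((k * sg k : ℤ) : A) * x^tri k) * (u M) := by
    intro k hk
    by_cases ht : M + 1 ≤ tri k
    · have : x^tri k = 0 := by
        rw [show tri k = M+1 + (tri k - (M+1)) by omega, pow_add, hx]; simp
      simp [an, this]
    · have hh := two_mul_tri k
      have h1 : -(M:ℤ) - 1 ≤ k := by
        by_contra hc
        push Not at hc ht
        nlinarith
      have h2 : k ≤ M + 2 := by
        by_contra hc
        push Not at hc ht
        nlinarith
      unfold an iq
      rw [if_neg (by push_cast; omega), if_neg (by push_cast; omega),
        u_stab x u hu M hx (((2*M+1:ℕ):ℤ) + k).toNat (by push_cast; omega),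
        u_stab x u hu M hx (((2*M+1:ℕ):ℤ) + 1 - k).toNat (by push_cast; omega), qP_stab x M hx (2*(2*M+1)+1) (by omega)]
      push_cast
      linear_combination (k * sg k * x^tri k * u M) * hu M
  rw [Finset.sum_congr rfl e, ← Finset.sum_mul] at h
  have hr : ∑ k ∈ Finset.Icc (-(2*M+1:ℕ):ℤ) ((2*M+1:ℕ)+1), ((k * sg k : ℤ) : A) * x^tri k
     = ∑ k ∈ Finset.Icc (-(2*M+1:ℕ):ℤ) ((2*M+1:ℕ)+1), (((k-1) * sg k : ℤ) : A) * x^tri k := by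
    refine Finset.sum_bij' (fun k _ => 1 - k) (fun k _ => 1 - k) ?_ ?_ ?_ ?_ ?_
    · intro a ha; simp only [Finset.mem_Icc] at *; omega
    · intro a ha; simp only [Finset.mem_Icc] at *; omega
    · intro a _; ring
    · intro a _; ring
    · intro k _
      have t : tri (1-k) = tri k := by
        have := two_mul_tri k; have h2 := two_mul_tri (1-k); 
        have : (2 * tri (1-k) : ℤ) = 2 * tri k := by rw [this, h2]; ring
        omega
      have s : sg (1-k) = - sg k := by unfold sg; split_ifs <;> omega
      rw [t, s]; congr 2; ring
  have e3 : ∑ k ∈ Finset.Icc (-(2*M+1:ℕ):ℤ) ((2*M+1:ℕ)+1), ((sg k * (2*k-1) : ℤ) : A) * x ^ tri k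
    = 2 * ∑ k ∈ Finset.Icc (-(2*M+1:ℕ):ℤ) ((2*M+1:ℕ)+1), ((k * sg k : ℤ) : A) * x^tri k := by
    rw [two_mul (∑ k ∈ Finset.Icc (-(2*M+1:ℕ):ℤ) ((2*M+1:ℕ)+1), ((k * sg k : ℤ) : A) * x^tri k)]; nth_rw 2 [hr]
    rw [← Finset.sum_add_distrib]
    apply Finset.sum_congr rfl; intro k _; push_cast; ring
  rw [e3]
  have := hu M
  generalize ∑ k ∈ Finset.Icc (-(2*M+1:ℕ):ℤ) ((2*M+1:ℕ)+1), ((k * sg k : ℤ) : A) * x^tri k = S at *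
  linear_combination (2 * qP x M) * h - 2 * S * this

end jac

section ps
open PowerSeries

instance fact5 : Fact (Nat.Prime 5) := ⟨by norm_num⟩

abbrev K5 := PowerSeries (ZMod 5)

lemma coeff_pow5 (f : K5) (m : ℕ) (hm : ¬ 5 ∣ m) : coeff m (f^5) = 0 := by
  have h := MvPowerSeries.map_frobenius_expand (R := ZMod 5) 5 (by norm_num) (f := f)
  have h' : (PowerSeries.map (frobenius (ZMod 5) 5)) (PowerSeries.expand 5 (by norm_num) f) = f^5 := h
  rw [← h', PowerSeries.coeff_map, PowerSeries.coeff_expand_of_not_dvd _ _ _ hm]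
  simp

lemma qP_const (m : ℕ) : constantCoeff (qP (X : K5) m) = 1 := by
  simp [qP, map_prod]

noncomputable def uu (m : ℕ) : K5 := (qP (X : K5) m)⁻¹

lemma uu_mul (m : ℕ) : uu m * qP (X : K5) m = 1 :=
  PowerSeries.inv_mul_cancel _ (by rw [qP_const]; exact one_ne_zero)

lemma qP_map {A B : Type*} [CommRing A] [CommRing B] (φ : A →+* B) (x : A) (m : ℕ) :
    φ (qP x m) = qP (φ x) m := by
  simp [qP, map_prod]

lemma tri_mod (k : ℤ) (h : tri k % 5 = 2 ∨ tri k % 5 = 3 ∨ tri k % 5 = 4) : (5:ℤ) ∣ 2 * k - 1 := by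
  have h2 := two_mul_tri k
  have h3 : (2 * (tri k : ℤ)) % 5 = ((k % 5) * ((k - 1) % 5)) % 5 := by
    rw [h2, Int.mul_emod]
  have : k % 5 = 0 ∨ k % 5 = 1 ∨ k % 5 = 2 ∨ k % 5 = 3 ∨ k % 5 = 4 := by omega
  rcases this with h5 | h5 | h5 | h5 | h5
  · rw [h5] at h3; omega
  · rw [h5, show (k-1)%5 = 0 by omega] at h3; omega
  · rw [h5, show (k-1)%5 = 1 by omega] at h3; omega
  · omega
  · rw [h5, show (k-1)%5 = 3 by omega] at h3; omega

lemma coeff_cube (M m : ℕ) (hm : m ≤ M) (h : m % 5 = 2 ∨ m % 5 = 3 ∨ m % 5 = 4) :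
    coeff m ((qP (X : K5) M)^3) = 0 := by
  let φ := Ideal.Quotient.mk (Ideal.span {(X : K5)^(M+1)})
  have hx : (φ X)^(M+1) = 0 := by
    rw [← map_pow]; exact Ideal.Quotient.eq_zero_iff_mem.2 (Ideal.mem_span_singleton_self _)
  have hj := jac_nil (φ X) (fun m => φ (uu m)) (fun m => by
    rw [← qP_map, ← map_mul, uu_mul, map_one]) M hx
  have hd : φ (2 * (qP (X : K5) M)^3 + ∑ k ∈ Finset.Icc (-(2*M+1:ℕ):ℤ) ((2*M+1:ℕ)+1),
      ((sg k * (2*k-1) : ℤ) : K5) * X ^ tri k) = 0 := by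
    rw [map_add, map_mul, map_pow, qP_map, map_ofNat, hj, map_sum]
    simp only [map_mul, map_pow, map_intCast]
    ring
  have hd2 := Ideal.mem_span_singleton.1 (Ideal.Quotient.eq_zero_iff_mem.1 hd)
  rw [PowerSeries.X_pow_dvd_iff] at hd2
  have h3 := hd2 m (by omega)
  rw [map_add, map_sum, Finset.sum_eq_zero, add_zero] at h3
  · have e : coeff m (2 * (qP (X : K5) M)^3) = 2 * coeff m ((qP (X : K5) M)^3) := by
      rw [two_mul, map_add, two_mul]
    rw [e] at h3
    have : (2 : ZMod 5) ≠ 0 := by decide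
    simpa [this] using h3
  · intro k _
    have e : (((sg k * (2*k-1) : ℤ) : K5)) = C (((sg k * (2*k-1) : ℤ)) : ZMod 5) :=
      (map_intCast (C (R := ZMod 5)) _).symm
    rw [e, PowerSeries.coeff_C_mul, PowerSeries.coeff_X_pow]
    split_ifs with hk
    · rw [hk] at h
      have : (((sg k * (2*k-1) : ℤ)) : ZMod 5) = 0 := by
        rw [ZMod.intCast_zmod_eq_zero_iff_dvd]
        exact Dvd.dvd.mul_left (tri_mod k h) _
      rw [this]; simp
    · simp

lemma coeff_main (M m a b : ℕ) (hm : m ≤ M) (ha : M ≤ a) (hb : M ≤ b)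
    (h : m % 5 = 2 ∨ m % 5 = 3 ∨ m % 5 = 4) : coeff m (uu a * uu b) = 0 := by
  let φ := Ideal.Quotient.mk (Ideal.span {(X : K5)^(M+1)})
  have hx : (φ X)^(M+1) = 0 := by
    rw [← map_pow]; exact Ideal.Quotient.eq_zero_iff_mem.2 (Ideal.mem_span_singleton_self _)
  have hu := u_stab (φ X) (fun m => φ (uu m)) (fun m => by
    rw [← qP_map, ← map_mul, uu_mul, map_one]) M hx
  have hd : φ (uu a * uu b - uu M * uu M) = 0 := by
    have h1 := hu a ha
    have h2 := hu b hb
    rw [map_sub, map_mul, h1, h2, map_mul, sub_self]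
  have hd2 := Ideal.mem_span_singleton.1 (Ideal.Quotient.eq_zero_iff_mem.1 hd)
  rw [PowerSeries.X_pow_dvd_iff] at hd2
  have h3 := hd2 m (by omega)
  rw [map_sub, sub_eq_zero] at h3
  rw [h3]
  have e : uu M * uu M = (qP (X : K5) M)^3 * (uu M)^5 := by
    have := uu_mul M
    have h2 : (uu M * qP (X : K5) M)^3 = 1 := by rw [this]; simp
    linear_combination (- uu M * uu M) * h2
  rw [e, PowerSeries.coeff_mul]
  apply Finset.sum_eq_zero
  rintro ⟨i, k⟩ hik
  rw [Finset.HasAntidiagonal.mem_antidiagonal] at hik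
  dsimp only at hik ⊢
  by_cases hk : 5 ∣ k
  · rw [coeff_cube M i (by omega) (by omega), zero_mul]
  · rw [coeff_pow5 _ _ hk, mul_zero]

/-- finsets of size k and sum s -/
def FS (k s : ℕ) : Finset (Finset ℕ) :=
  ((Finset.range (s+1)).powersetCard k).filter (fun S => ∑ i ∈ S, i = s)

lemma mem_FS (k s : ℕ) (S : Finset ℕ) : S ∈ FS k s ↔ S.card = k ∧ ∑ i ∈ S, i = s := by
  simp only [FS, Finset.mem_filter, Finset.mem_powersetCard]
  constructor
  · rintro ⟨⟨_, h⟩, h2⟩; exact ⟨h, h2⟩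
  · rintro ⟨h, h2⟩
    refine ⟨⟨?_, h⟩, h2⟩
    intro i hi
    have := Finset.single_le_sum (f := fun i => i) (fun i _ => Nat.zero_le i) hi
    rw [Finset.mem_range]; omega

def shf (S : Finset ℕ) : Finset ℕ := S.map ⟨(· + 1), add_left_injective 1⟩

lemma shf_card (S : Finset ℕ) : (shf S).card = S.card := by simp [shf]
lemma shf_sum (S : Finset ℕ) : ∑ i ∈ shf S, i = ∑ i ∈ S, i + S.card := by
  simp [shf, Finset.sum_add_distrib]
lemma shf_inj : Function.Injective shf := Finset.map_injective _
lemma shf_zero (S : Finset ℕ) : 0 ∉ shf S := by simp [shf]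
lemma shf_surj (S : Finset ℕ) (h : 0 ∉ S) : ∃ T, shf T = S := by
  refine ⟨S.image (· - 1), ?_⟩
  ext x
  simp only [shf, Finset.mem_map, Finset.mem_image, Function.Embedding.coeFn_mk]
  constructor
  · rintro ⟨_, ⟨y, hy, rfl⟩, rfl⟩
    have : y ≠ 0 := fun h0 => h (h0 ▸ hy)
    rwa [show y - 1 + 1 = y by omega]
  · intro hx
    have : x ≠ 0 := fun h0 => h (h0 ▸ hx)
    exact ⟨x - 1, ⟨x, hx, rfl⟩, by omega⟩

lemma FS_rec (k s : ℕ) : (FS (k+1) s).card =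
    (if k + 1 ≤ s then (FS (k+1) (s-(k+1))).card else 0) + (if k ≤ s then (FS k (s-k)).card else 0) := by
  rw [← Finset.card_filter_add_card_filter_not (s := FS (k+1) s) (fun S => 0 ∉ S)]
  congr 1
  · split_ifs with h
    · symm
      refine Finset.card_bij (fun S _ => shf S) ?_ ?_ ?_
      · intro S hS
        rw [mem_FS] at hS
        rw [Finset.mem_filter, mem_FS, shf_card, shf_sum]
        exact ⟨⟨hS.1, by omega⟩, shf_zero S⟩
      · intro a _ b _ h; exact shf_inj h
      · intro S hS
        rw [Finset.mem_filter, mem_FS] at hS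
        obtain ⟨T, rfl⟩ := shf_surj S hS.2
        rw [shf_card, shf_sum] at hS
        exact ⟨T, by rw [mem_FS]; omega, rfl⟩
    · rw [Finset.card_eq_zero, Finset.filter_eq_empty_iff]
      intro S hS h0
      rw [mem_FS] at hS
      obtain ⟨T, rfl⟩ := shf_surj S h0
      rw [shf_card, shf_sum] at hS
      omega
  · split_ifs with h
    · symm
      refine Finset.card_bij (fun S _ => insert 0 (shf S)) ?_ ?_ ?_
      · intro S hS
        rw [mem_FS] at hS
        rw [Finset.mem_filter, mem_FS, Finset.card_insert_of_notMem (shf_zero S),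
          Finset.sum_insert (shf_zero S), shf_card, shf_sum]
        exact ⟨⟨by omega, by omega⟩, by simp⟩
      · intro a _ b _ h
        apply shf_inj
        have := congrArg (fun S => Finset.erase S 0) h
        simpa [Finset.erase_insert (shf_zero _)] using this
      · intro S hS
        rw [Finset.mem_filter, mem_FS, not_not] at hS
        obtain ⟨T, hT⟩ := shf_surj (S.erase 0) (by simp)
        have e : insert 0 (shf T) = S := by rw [hT, Finset.insert_erase hS.2]
        refine ⟨T, ?_, e⟩
        rw [← e, Finset.card_insert_of_notMem (shf_zero T),
          Finset.sum_insert (shf_zero T), shf_card, shf_sum] at hS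
        rw [mem_FS]; omega
    · rw [Finset.card_eq_zero, Finset.filter_eq_empty_iff]
      intro S hS h0
      rw [not_not] at h0
      rw [mem_FS] at hS
      obtain ⟨T, hT⟩ := shf_surj (S.erase 0) (by simp)
      have e : insert 0 (shf T) = S := by rw [hT, Finset.insert_erase h0]
      rw [← e, Finset.card_insert_of_notMem (shf_zero T),
          Finset.sum_insert (shf_zero T), shf_card, shf_sum] at hS
      omega

noncomputable def FF (k : ℕ) : K5 := PowerSeries.mk fun s => ((FS k s).card : ZMod 5)

lemma FF_zero : FF 0 = 1 := by
  ext s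
  rw [FF, coeff_mk, coeff_one]
  by_cases h : s = 0
  · subst h
    have : FS 0 0 = {∅} := by
      ext S; rw [mem_FS]; simp; rintro rfl; simp
    simp [this]
  · have : FS 0 s = ∅ := by
      ext S; rw [mem_FS]; simp; rintro rfl; simpa using Ne.symm h
    simp [this, h]

lemma FF_rec (k : ℕ) : FF (k+1) = FF (k+1) * X^(k+1) + FF k * X^k := by
  ext s
  rw [map_add, coeff_mul_X_pow', coeff_mul_X_pow']
  simp only [FF, coeff_mk]
  rw [FS_rec]
  push_cast
  split_ifs <;> simp

lemma FF_eq (k : ℕ) : FF k = X^(tri k) * uu k := by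
  have key : FF k * qP X k = X^(tri k) := by
    induction k with
    | zero => simp [FF_zero, qP, tri]
    | succ k ih =>
      have e : tri ((k+1:ℕ):ℤ) = tri k + k := by have := tri_add k; push_cast; omega
      rw [qP_succ, e, pow_add X (tri k) k, ← ih]
      linear_combination (qP X k) * FF_rec k
  linear_combination uu k * key - FF k * uu_mul k

lemma FF_coeff (a b t M : ℕ) (ha : M ≤ a) (hb : M ≤ b) 
    (h : ∀ m, t = tri a + tri b + m → m ≤ M ∧ (m % 5 = 2 ∨ m % 5 = 3 ∨ m % 5 = 4)) :
    5 ∣ ∑ p ∈ Finset.HasAntidiagonal.antidiagonal t, (FS a p.1).card * (FS b p.2).card := by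
  rw [← ZMod.natCast_eq_zero_iff]
  have e : ((∑ p ∈ Finset.HasAntidiagonal.antidiagonal t, (FS a p.1).card * (FS b p.2).card : ℕ) : ZMod 5)
      = coeff t (FF a * FF b) := by
    rw [coeff_mul]; simp [FF]
  rw [e, FF_eq, FF_eq, show X^tri a * uu a * (X^tri b * uu b) = (uu a * uu b) * X^(tri a + tri b) by
    rw [pow_add]; ring, coeff_mul_X_pow']
  split_ifs with h0
  · obtain ⟨h1, h2⟩ := h (t - (tri a + tri b)) (by omega)
    exact coeff_main M _ a b h1 ha hb h2
  · rfl

end ps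

section lists

def beta : List ℕ → List ℕ
  | [] => []
  | a :: l => (a + l.length) :: beta l

def unbeta : List ℕ → List ℕ
  | [] => []
  | a :: l => (a - l.length) :: unbeta l

lemma beta_length (l : List ℕ) : (beta l).length = l.length := by
  induction l with
  | nil => rfl
  | cons a l ih => simp [beta, ih]

lemma unbeta_length (l : List ℕ) : (unbeta l).length = l.length := by
  induction l with
  | nil => rfl
  | cons a l ih => simp [unbeta, ih]

lemma unbeta_beta (l : List ℕ) : unbeta (beta l) = l := by
  induction l with
  | nil => rfl
  | cons a l ih => simp [beta, unbeta, ih, beta_length]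

lemma mem_beta_lt (l : List ℕ) (a : ℕ) (h : ∀ x ∈ l, x ≤ a) : ∀ y ∈ beta l, y < a + l.length := by
  induction l with
  | nil => simp [beta]
  | cons b l ih =>
    intro y hy
    simp only [beta, List.mem_cons, List.length_cons] at *
    rcases hy with rfl | hy
    · have := h b (Or.inl rfl); omega
    · have := ih (fun x hx => h x (Or.inr hx)) y hy; omega

lemma beta_sorted (l : List ℕ) (h : l.Pairwise (· ≥ ·)) : (beta l).Pairwise (· > ·) := by
  induction l with
  | nil => simp [beta]
  | cons a l ih =>
    rw [List.pairwise_cons] at h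
    rw [beta, List.pairwise_cons]
    exact ⟨mem_beta_lt l a h.1, ih h.2⟩

lemma len_le (l : List ℕ) (h : l.Pairwise (· > ·)) (a : ℕ) (ha : ∀ x ∈ l, x < a) : l.length ≤ a := by
  induction l generalizing a with
  | nil => simp
  | cons b l ih =>
    rw [List.pairwise_cons] at h
    have h1 := ih h.2 b h.1
    have h2 := ha b (by simp)
    simp only [List.length_cons]; omega

lemma beta_unbeta (l : List ℕ) (h : l.Pairwise (· > ·)) : beta (unbeta l) = l := by
  induction l with
  | nil => rfl
  | cons a l ih =>
    rw [List.pairwise_cons] at h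
    rw [unbeta, beta, ih h.2, unbeta_length, Nat.sub_add_cancel (len_le l h.2 a h.1)]

lemma unbeta_sorted (l : List ℕ) (h : l.Pairwise (· > ·)) : (unbeta l).Pairwise (· ≥ ·) := by
  induction l with
  | nil => simp [unbeta]
  | cons a l ih =>
    rw [List.pairwise_cons] at h
    have ih' := ih h.2
    rw [unbeta, List.pairwise_cons]
    refine ⟨?_, ih'⟩
    cases l with
    | nil => simp [unbeta]
    | cons b l =>
      have hb := h.1 b (by simp)
      intro y hy
      rw [unbeta] at hy ih'
      rw [List.pairwise_cons] at ih'
      simp only [List.mem_cons, List.length_cons] at *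
      rcases hy with rfl | hy
      · omega
      · have := ih'.1 y hy; omega

lemma beta_sum (l : List ℕ) : ((beta l).sum : ℤ) = l.sum + tri l.length := by
  induction l with
  | nil => simp [beta, tri]
  | cons a l ih =>
    have := tri_add l.length
    simp only [beta, List.sum_cons, List.length_cons]
    rw [Nat.cast_add, ih, Nat.cast_add, Nat.cast_add, Nat.cast_add, Nat.cast_one, this]
    ring

lemma bgRank_cons (a : ℕ) (l : List ℕ) : bgRank (a :: l) = (a : ℤ) % 2 - bgRank l := by
  unfold bgRank
  rw [List.length_cons, Finset.sum_range_succ']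
  simp only [List.getD_cons_succ, List.getD_cons_zero, pow_succ]
  simp
  ring

def evc (l : List ℕ) : ℕ := l.countP (fun x => x % 2 = 0)

lemma bg_beta (l : List ℕ) : bgRank l =
    if l.length % 2 = 0 then (evc (beta l) : ℤ) - (l.length / 2 : ℕ)
    else ((l.length + 1) / 2 : ℕ) - (evc (beta l) : ℤ) := by
  induction l with
  | nil => simp [bgRank, beta, evc]
  | cons a l ih =>
    rw [bgRank_cons, ih]
    unfold evc at *
    simp only [beta, List.countP_cons, List.length_cons]
    generalize List.countP (fun x => decide (x % 2 = 0)) (beta l) = E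
    simp only [decide_eq_true_eq]
    split_ifs <;> push_cast <;> omega

lemma bg_append (l : List ℕ) (c : ℕ) : bgRank (l ++ List.replicate c 0) = bgRank l := by
  induction l with
  | nil =>
    induction c with
    | zero => rfl
    | succ c ih =>
      rw [List.nil_append] at *
      rw [List.replicate_succ, bgRank_cons, ih]; simp [bgRank]
  | cons a l ih => rw [List.cons_append, bgRank_cons, ih, bgRank_cons]

lemma len_le_sum (l : List ℕ) (h : ∀ x ∈ l, 0 < x) : l.length ≤ l.sum := by
  induction l with
  | nil => simp
  | cons a l ih =>
    have h1 := ih (fun x hx => h x (by simp [hx]))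
    have h2 := h a (by simp)
    simp only [List.length_cons, List.sum_cons]; omega

lemma filt_pad (L : List ℕ) (h : L.Pairwise (· ≥ ·)) :
    ∃ l c, L = l ++ List.replicate c 0 ∧ IsPartition l := by
  induction L with
  | nil => exact ⟨[], 0, by simp, by simp [IsPartition]⟩
  | cons a L ih =>
    rw [List.pairwise_cons] at h
    obtain ⟨l, c, hL, hl⟩ := ih h.2
    by_cases ha : a = 0
    · have : l = [] := by
        rw [List.eq_nil_iff_forall_not_mem]
        intro x hx
        have h1 := h.1 x (by simp [hL, hx])
        have h2 := hl.2 x hx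
        omega
      subst this
      refine ⟨[], c+1, ?_, hl⟩
      rw [hL, ha]; simp [List.replicate_succ]
    · refine ⟨a :: l, c, by simp [hL], ?_, ?_⟩
      · rw [List.pairwise_cons]
        exact ⟨fun x hx => h.1 x (by simp [hL, hx]), hl.1⟩
      · intro x hx
        rw [List.mem_cons] at hx
        rcases hx with rfl | hx
        · omega
        · exact hl.2 x hx

def pad (K : ℕ) (l : List ℕ) : List ℕ := l ++ List.replicate (K - l.length) 0

lemma pad_sorted (K : ℕ) (l : List ℕ) (h : IsPartition l) : (pad K l).Pairwise (· ≥ ·) := by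
  rw [pad, List.pairwise_append]
  refine ⟨h.1, ?_, ?_⟩
  · simp [List.pairwise_replicate]
  · intro a _ b hb
    rw [List.mem_replicate] at hb
    omega

lemma pad_inj (K : ℕ) (l l' : List ℕ) (h : IsPartition l) (h' : IsPartition l')
    (e : pad K l = pad K l') : l = l' := by
  have key : ∀ l : List ℕ, IsPartition l → (pad K l).filter (fun x => 0 < x) = l := by
    intro l h
    rw [pad, List.filter_append, List.filter_eq_self.2 (by simpa using h.2)]
    simp
  rw [← key l h, e, key l' h']

lemma pad_length (K : ℕ) (l : List ℕ) (h : l.length ≤ K) : (pad K l).length = K := by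
  simp [pad]; omega

lemma pad_sum (K : ℕ) (l : List ℕ) : (pad K l).sum = l.sum := by simp [pad]

/-- finsets of size 2N, sum s, with N+j even elements -/
def Tset (K s e : ℕ) : Finset (Finset ℕ) :=
  (FS K s).filter (fun S => (S.filter (fun x => x % 2 = 0)).card = e)

lemma toFinset_facts (l : List ℕ) (h : l.Pairwise (· > ·)) :
    l.toFinset.card = l.length ∧ ∑ i ∈ l.toFinset, i = l.sum ∧
    (l.toFinset.filter (fun x => x % 2 = 0)).card = evc l := by
  have hn : l.Nodup := h.imp (fun h => by omega)
  refine ⟨List.toFinset_card_of_nodup hn, ?_, ?_⟩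
  · rw [List.sum_toFinset _ hn]; simp
  · rw [evc, List.countP_eq_length_filter, ← List.toFinset_card_of_nodup (hn.filter _), List.toFinset_filter]
    simp

lemma pj_eq (N n s e : ℕ) (j : ℤ) (hn : n ≤ 2 * N) (hs : s = n + tri (2*N:ℕ))
    (he : (e : ℤ) = N + j) : pj j n = (Tset (2*N) s e).card := by
  have fact : ∀ L : List ℕ, L.Pairwise (· ≥ ·) → L.length = 2*N →
      (bgRank L = j ∧ L.sum = n ↔ (beta L).toFinset ∈ Tset (2*N) s e) := by
    intro L hL hlen
    obtain ⟨f1, f2, f3⟩ := toFinset_facts _ (beta_sorted L hL)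
    rw [Tset, Finset.mem_filter, mem_FS, f1, f2, f3, beta_length]
    have b1 := beta_sum L
    have b2 := bg_beta L
    rw [if_pos (by omega)] at b2
    rw [hlen] at b1 b2
    omega
  have fl : ∀ l : List ℕ, IsPartition l → l.sum = n → (pad (2*N) l).length = 2*N := by
    intro l hl hsum
    apply pad_length
    have := len_le_sum l hl.2
    omega
  rw [pj, ← Nat.card_eq_finsetCard]
  refine Nat.card_eq_of_bijective (fun l => ⟨(beta (pad (2*N) l.1)).toFinset, ?_⟩) ⟨?_, ?_⟩
  · obtain ⟨l, hl, hsum, hb⟩ := l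
    refine (fact _ (pad_sorted _ l hl) (fl l hl hsum)).1 ⟨?_, ?_⟩
    · rw [pad, bg_append, hb]
    · rw [pad_sum, hsum]
  · rintro ⟨l, hl, hsum, hb⟩ ⟨l', hl', hsum', hb'⟩ h
    simp only [Subtype.mk.injEq] at h ⊢
    apply pad_inj (2*N) l l' hl hl'
    rw [← unbeta_beta (pad (2*N) l), ← unbeta_beta (pad (2*N) l')]
    congr 1
    have s1 := beta_sorted _ (pad_sorted (2*N) l hl)
    have s2 := beta_sorted _ (pad_sorted (2*N) l' hl')
    have n1 : (beta (pad (2*N) l)).Nodup := s1.imp (fun h => by omega)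
    have n2 : (beta (pad (2*N) l')).Nodup := s2.imp (fun h => by omega)
    have hp := List.perm_of_nodup_nodup_toFinset_eq n1 n2 h
    exact List.Perm.eq_of_pairwise (fun a b _ _ h1 h2 => by omega) s1 s2 hp
  · rintro ⟨S, hS⟩
    have hsrt : (S.sort (· ≥ ·)).Pairwise (· > ·) := by
      have h1 := Finset.pairwise_sort S (· ≥ ·)
      have h2 := Finset.sort_nodup S (· ≥ ·)
      exact (List.Pairwise.and h1 h2).imp (fun ⟨a, b⟩ => by omega)
    have hU := unbeta_sorted _ hsrt
    have hb := beta_unbeta _ hsrt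
    have hlen : (unbeta (S.sort (· ≥ ·))).length = 2*N := by
      rw [unbeta_length, Finset.length_sort]
      rw [Tset, Finset.mem_filter, mem_FS] at hS
      exact hS.1.1
    obtain ⟨l, c, hL, hl⟩ := filt_pad _ hU
    have hpad : unbeta (S.sort (· ≥ ·)) = pad (2*N) l := by
      rw [pad, hL]; congr 2
      rw [hL] at hlen; simp at hlen; omega
    have hf := fact _ hU hlen
    rw [hb, Finset.sort_toFinset] at hf
    obtain ⟨g1, g2⟩ := hf.2 hS
    refine ⟨⟨l, hl, ?_, ?_⟩, ?_⟩
    · rw [hpad, pad_sum] at g2; exact g2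
    · rw [hL, bg_append] at g1; exact g1
    · simp only [Subtype.mk.injEq]
      rw [← hpad, hb, Finset.sort_toFinset]

def cmb (A B : Finset ℕ) : Finset ℕ := A.image (fun x => 2*x) ∪ B.image (fun x => 2*x+1)

lemma cmb_disj (A B : Finset ℕ) : Disjoint (A.image (fun x => 2*x)) (B.image (fun x => 2*x+1)) := by
  rw [Finset.disjoint_left]
  intro x hx hy
  simp only [Finset.mem_image] at hx hy
  obtain ⟨a, _, ha⟩ := hx
  obtain ⟨b, _, hb⟩ := hy
  omega

lemma cmb_card (A B : Finset ℕ) : (cmb A B).card = A.card + B.card := by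
  rw [cmb, Finset.card_union_of_disjoint (cmb_disj A B),
    Finset.card_image_of_injective _ (fun a b h => by simpa using h),
    Finset.card_image_of_injective _ (fun a b h => by simpa using h)]

lemma cmb_sum (A B : Finset ℕ) : ∑ i ∈ cmb A B, i = 2 * ∑ i ∈ A, i + 2 * ∑ i ∈ B, i + B.card := by
  rw [cmb, Finset.sum_union (cmb_disj A B),
    Finset.sum_image (fun a _ b _ h => by simpa using h),
    Finset.sum_image (fun a _ b _ h => by simpa using h), Finset.sum_add_distrib,
    ← Finset.mul_sum, ← Finset.mul_sum]
  simp [add_assoc]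

lemma cmb_mem0 (A B : Finset ℕ) (x : ℕ) : 2 * x ∈ cmb A B ↔ x ∈ A := by
  simp only [cmb, Finset.mem_union, Finset.mem_image]
  constructor
  · rintro (⟨a, ha, h⟩ | ⟨a, ha, h⟩)
    · rwa [show x = a by omega]
    · omega
  · intro h; exact Or.inl ⟨x, h, rfl⟩

lemma cmb_mem1 (A B : Finset ℕ) (x : ℕ) : 2 * x + 1 ∈ cmb A B ↔ x ∈ B := by
  simp only [cmb, Finset.mem_union, Finset.mem_image]
  constructor
  · rintro (⟨a, ha, h⟩ | ⟨a, ha, h⟩)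
    · omega
    · rwa [show x = a by omega]
  · intro h; exact Or.inr ⟨x, h, rfl⟩

lemma cmb_even (A B : Finset ℕ) : ((cmb A B).filter (fun x => x % 2 = 0)).card = A.card := by
  have : (cmb A B).filter (fun x => x % 2 = 0) = A.image (fun x => 2*x) := by
    ext x
    simp only [cmb, Finset.mem_filter, Finset.mem_union, Finset.mem_image]
    constructor
    · rintro ⟨h | ⟨b, _, h⟩, h2⟩
      · exact h
      · omega
    · rintro ⟨a, ha, h⟩; exact ⟨Or.inl ⟨a, ha, h⟩, by omega⟩
  rw [this, Finset.card_image_of_injective _ (fun a b h => by simpa using h)]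

lemma cmb_surj (S : Finset ℕ) : ∃ A B, cmb A B = S := by
  refine ⟨(S.filter (fun x => x % 2 = 0)).image (· / 2), (S.filter (fun x => x % 2 = 1)).image (· / 2), ?_⟩
  ext x
  rcases Nat.even_or_odd' x with ⟨c, rfl | rfl⟩
  · rw [cmb_mem0]
    simp only [Finset.mem_image, Finset.mem_filter]
    constructor
    · rintro ⟨a, ⟨h1, h2⟩, h3⟩; rwa [show 2 * c = a by omega]
    · intro h; exact ⟨2*c, ⟨h, by omega⟩, by omega⟩
  · rw [cmb_mem1]
    simp only [Finset.mem_image, Finset.mem_filter]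
    constructor
    · rintro ⟨a, ⟨h1, h2⟩, h3⟩; rwa [show 2 * c + 1 = a by omega]
    · intro h; exact ⟨2*c+1, ⟨h, by omega⟩, by omega⟩

lemma Tset_card (e f t : ℕ) : (Tset (e+f) (2*t+f) e).card =
    ∑ p ∈ Finset.HasAntidiagonal.antidiagonal t, (FS e p.1).card * (FS f p.2).card := by
  simp_rw [← Finset.card_product]
  rw [← Finset.card_sigma]
  symm
  refine Finset.card_bij (fun q _ => cmb q.2.1 q.2.2) ?_ ?_ ?_
  · rintro ⟨⟨a, b⟩, ⟨A, B⟩⟩ h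
    simp only [Finset.mem_sigma, Finset.mem_product, mem_FS,
      Finset.HasAntidiagonal.mem_antidiagonal] at h
    rw [Tset, Finset.mem_filter, mem_FS, cmb_card, cmb_sum, cmb_even]
    dsimp only
    omega
  · rintro ⟨⟨a, b⟩, ⟨A, B⟩⟩ h ⟨⟨a', b'⟩, ⟨A', B'⟩⟩ h' hc
    simp only [Finset.mem_sigma, Finset.mem_product, mem_FS,
      Finset.HasAntidiagonal.mem_antidiagonal] at h h'
    dsimp only at hc
    have hA : A = A' := by ext x; rw [← cmb_mem0 A B, hc, cmb_mem0]
    have hB : B = B' := by ext x; rw [← cmb_mem1 A B, hc, cmb_mem1]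
    subst hA hB
    obtain ⟨_, ⟨_, rfl⟩, ⟨_, rfl⟩⟩ := h
    obtain ⟨_, ⟨_, rfl⟩, ⟨_, rfl⟩⟩ := h'
    rfl
  · intro S hS
    obtain ⟨A, B, rfl⟩ := cmb_surj S
    rw [Tset, Finset.mem_filter, mem_FS, cmb_card, cmb_sum, cmb_even] at hS
    refine ⟨⟨(∑ i ∈ A, i, ∑ i ∈ B, i), (A, B)⟩, ?_, rfl⟩
    simp only [Finset.mem_sigma, Finset.mem_product, mem_FS,
      Finset.HasAntidiagonal.mem_antidiagonal, and_true]
    omega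

lemma Tset_empty (e f s : ℕ) (h : ¬ ∃ t, s = 2*t+f) : (Tset (e+f) s e).card = 0 := by
  rw [Finset.card_eq_zero, Finset.eq_empty_iff_forall_notMem]
  intro S hS
  obtain ⟨A, B, rfl⟩ := cmb_surj S
  rw [Tset, Finset.mem_filter, mem_FS, cmb_card, cmb_sum, cmb_even] at hS
  exact h ⟨∑ i ∈ A, i + ∑ i ∈ B, i, by omega⟩

end lists

theorem pj_five_mul_add_one_cong (n : ℕ) (j : ℤ)
    (hj : j % 5 = 0 ∨ j % 5 = 3 ∨ j % 5 = 4) :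
    (5 : ℕ) ∣ pj j (5 * n + 1) := by
  obtain ⟨M, hM⟩ : ∃ M, M = 5 * n + 1 + j.natAbs := ⟨_, rfl⟩
  obtain ⟨N, hN⟩ : ∃ N, N = M + j.natAbs := ⟨_, rfl⟩
  obtain ⟨e, he⟩ : ∃ e : ℕ, (e : ℤ) = N + j := ⟨(N + j).toNat, by omega⟩
  obtain ⟨f, hf⟩ : ∃ f : ℕ, (f : ℤ) = N - j := ⟨(N - j).toNat, by omega⟩
  rw [pj_eq N (5*n+1) _ e j (by omega) rfl he, show 2 * N = e + f by omega]
  by_cases ht : ∃ t, 5 * n + 1 + tri ((e+f:ℕ):ℤ) = 2*t+f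
  · obtain ⟨t, ht⟩ := ht
    rw [ht, Tset_card]
    apply FF_coeff e f t M (by omega) (by omega)
    intro m hm
    have t1 := two_mul_tri ((e+f:ℕ):ℤ)
    have t2 := two_mul_tri e
    have t3 := two_mul_tri f
    have hef : ((e+f:ℕ):ℤ) = 2 * N := by omega
    have key : (2 * m : ℤ) = 5 * n + 1 + j - 2 * (j * j) := by
      zify at ht hm
      rw [he] at t2
      rw [hf] at t3
      push_cast at t1 ht
      rw [show (e + f : ℤ) = 2 * N by omega] at t1 ht
      rw [hf] at ht
      rw [he] at hm
      rw [hf] at hm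
      linarith
    constructor
    · have : 0 ≤ j * j := mul_self_nonneg j
      omega
    · have hjj : (j * j) % 5 = ((j % 5) * (j % 5)) % 5 := Int.mul_emod _ _ _
      generalize j * j = J at *
      rcases hj with h | h | h <;> rw [h] at hjj <;> omega
  · rw [Tset_empty e f _ ht]; exact dvd_zero 5
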